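/- A partial function G : {0,1}* → ℤ is partial recursive in ∅′ if and only if there exist total recursive functions g₁, g₂ : {0,1}* → {0,1}* such that for all p, G(p) = card(W_{g₁(p)}) − card(W_{g₂(p)}), defined exactly when both W_{g₁(p)} and W_{g₂(p)} are finite. -/

import Mathlib

/-- Codes for oracle partial recursive functions: `Nat.Partrec.Code` with an
extra constructor for one call to the oracle. -/
inductive OCode : Type
  | zero | succ | left | right | oracle
  | pair : OCode → OCode → OCode
  | comp : OCode → OCode → OCode
  | prec : OCode → OCode → OCode
  | rfind' : OCode → OCode

/-- Evaluation of an oracle code, relative to the oracle `O`. -/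
def evalo (O : ℕ →. ℕ) : OCode → ℕ →. ℕ
  | .zero => fun _ => Part.some 0
  | .succ => fun n => Part.some (n + 1)
  | .left => fun n => Part.some (Nat.unpair n).1
  | .right => fun n => Part.some (Nat.unpair n).2
  | .oracle => O
  | .pair cf cg => fun n => Nat.pair <$> evalo O cf n <*> evalo O cg n
  | .comp cf cg => fun n => evalo O cg n >>= evalo O cf
  | .prec cf cg => Nat.unpaired fun a n =>
      n.rec (evalo O cf a) fun y IH => do
        let i ← IH
        evalo O cg (Nat.pair a (Nat.pair y i))
  | .rfind' cf => Nat.unpaired fun a m =>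
      (Nat.rfind fun n => (fun x => x = 0) <$> evalo O cf (Nat.pair a (n + m))).map (· + m)

open Classical in
/-- The characteristic (total) partial function of a set of naturals. -/
noncomputable def chi (A : Set ℕ) : ℕ →. ℕ :=
  fun n => Part.some (if n ∈ A then 1 else 0)

/-- `f` is partial `A`-recursive (via encodings of `α` and `β`). -/
def RecInP {α β : Type*} [Primcodable α] [Primcodable β] (A : Set ℕ) (f : α →. β) : Prop :=
  ∃ c : OCode, ∀ a : α,
    evalo (chi A) c (Encodable.encode a) = (f a).map Encodable.encode

/-- An injective encoding of oracle codes into ℕ. -/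
def encOCode : OCode → ℕ
  | .zero => 0
  | .succ => 1
  | .left => 2
  | .right => 3
  | .oracle => 4
  | .pair a b => 4 * Nat.pair (encOCode a) (encOCode b) + 5
  | .comp a b => 4 * Nat.pair (encOCode a) (encOCode b) + 6
  | .prec a b => 4 * Nat.pair (encOCode a) (encOCode b) + 7
  | .rfind' a => 4 * encOCode a + 8

/-- The Turing jump A′ of A : the self-halting set relative to A. -/
def jump (A : Set ℕ) : Set ℕ :=
  {n | ∃ c : OCode, encOCode c = n ∧ (evalo (chi A) c n).Dom}

/-- The acceptable enumeration of A-r.e. subsets of ℕ: `W A e` is the domain of the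
A-partial recursive function coded by `e`. -/
def W (A : Set ℕ) (e : ℕ) : Set ℕ :=
  {n | ∃ c : OCode, encOCode c = e ∧ (evalo (chi A) c n).Dom}

/-- The cardinality of a set of naturals, as a partial value. -/
noncomputable def pcard (S : Set ℕ) : Part ℕ := ⟨S.Finite, fun _ => S.ncard⟩

/-- Difference of two partial naturals, as a partial integer;
defined exactly when both are. -/
def psub (a b : Part ℕ) : Part ℤ := do
  let x ← a
  let y ← b
  pure ((x : ℤ) - (y : ℤ))


open Nat.Partrec (Code)

/-- One step of the course-of-values recursion translating the number of an oracle code into a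
`Code`, given the list of translations of all smaller numbers; the oracle becomes `zero`. -/
def toCodeStep (l : List Code) : Code :=
  if l.length = 0 then .zero
  else if l.length = 1 then .succ
  else if l.length = 2 then .left
  else if l.length = 3 then .right
  else if l.length = 4 then .zero
  else
    let m := (l.length - 5) / 4
    let a := l.getD m.unpair.1 .zero
    let b := l.getD m.unpair.2 .zero
    if (l.length - 5) % 4 = 0 then .pair a b
    else if (l.length - 5) % 4 = 1 then .comp a b
    else if (l.length - 5) % 4 = 2 then .prec a b
    else .rfind' (l.getD m .zero)

/-- The translations of the numbers below `n`. -/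
def toCodeList (n : ℕ) : List Code :=
  n.rec [] fun _ l => l ++ [toCodeStep l]

/-- The translation of the number of an oracle code into a `Code` with the same values under the
empty oracle. -/
def toCode (n : ℕ) : Code := toCodeStep (toCodeList n)

theorem length_toCodeList (n : ℕ) : (toCodeList n).length = n := by
  induction n with
  | zero => rfl
  | succ n ih => simp only [toCodeList] at ih ⊢; simp [ih]

theorem getD_toCodeList {i n : ℕ} (h : i < n) : (toCodeList n).getD i .zero = toCode i := by
  induction n with
  | zero => omega
  | succ n ih =>
    have hs : toCodeList (n + 1) = toCodeList n ++ [toCode n] := rfl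
    rw [hs]
    rcases Nat.lt_succ_iff_lt_or_eq.1 h with h' | rfl
    · rw [List.getD_append _ _ _ _ (by rwa [length_toCodeList]), ih h']
    · rw [List.getD_append_right _ _ _ _ (by rw [length_toCodeList])]
      simp [length_toCodeList]

theorem primrec_toCodeStep : Primrec toCodeStep := by
  have hl : Primrec fun l : List Code => l.length := Primrec.list_length
  have hk : Primrec fun l : List Code => l.length - 5 := Primrec.nat_sub.comp hl (.const 5)
  have hm : Primrec fun l : List Code => (l.length - 5) / 4 := Primrec.nat_div.comp hk (.const 4)
  have hr : Primrec fun l : List Code => (l.length - 5) % 4 := Primrec.nat_mod.comp hk (.const 4)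
  have hget {f : List Code → ℕ} (hf : Primrec f) : Primrec fun l : List Code => l.getD (f l) Code.zero :=
    (Primrec.list_getD Code.zero).comp .id hf
  have ha := hget (Primrec.fst.comp (Primrec.unpair.comp hm))
  have hb := hget (Primrec.snd.comp (Primrec.unpair.comp hm))
  have heq {f : List Code → ℕ} (hf : Primrec f) (n : ℕ) : PrimrecPred fun l => f l = n :=
    Primrec.eq.comp hf (.const n)
  exact .ite (heq hl 0) (.const _) <| .ite (heq hl 1) (.const _) <| .ite (heq hl 2) (.const _) <|
    .ite (heq hl 3) (.const _) <| .ite (heq hl 4) (.const _) <|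
    .ite (heq hr 0) (Code.primrec₂_pair.comp ha hb) <|
    .ite (heq hr 1) (Code.primrec₂_comp.comp ha hb) <|
    .ite (heq hr 2) (Code.primrec₂_prec.comp ha hb) <|
    Code.primrec_rfind'.comp (hget hm)

theorem primrec_toCode : Primrec toCode :=
  primrec_toCodeStep.comp <| Primrec.nat_rec₁ [] <|
    Primrec.list_concat.comp Primrec.snd (primrec_toCodeStep.comp Primrec.snd)

theorem toCode_four_mul_add (m r : ℕ) (hr : r < 4) : toCode (4 * m + r + 5) =
    if r = 0 then .pair (toCode m.unpair.1) (toCode m.unpair.2)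
    else if r = 1 then .comp (toCode m.unpair.1) (toCode m.unpair.2)
    else if r = 2 then .prec (toCode m.unpair.1) (toCode m.unpair.2)
    else .rfind' (toCode m) := by
  have hm : (4 * m + r + 5 - 5) / 4 = m := by omega
  have hmod : (4 * m + r + 5 - 5) % 4 = r := by omega
  have h₁ : m.unpair.1 < 4 * m + r + 5 := (Nat.unpair_left_le m).trans_lt (by omega)
  have h₂ : m.unpair.2 < 4 * m + r + 5 := (Nat.unpair_right_le m).trans_lt (by omega)
  rw [toCode, toCodeStep, length_toCodeList, hm, hmod]
  dsimp only
  rw [getD_toCodeList h₁, getD_toCodeList h₂, getD_toCodeList (by omega)]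
  simp

theorem eval_toCode_encOCode (c : OCode) : (toCode (encOCode c)).eval = evalo (chi ∅) c := by
  induction c with
  | zero => rfl
  | succ => rfl
  | left => rfl
  | right => rfl
  | oracle =>
    funext n
    simp only [evalo, chi, Set.mem_empty_iff_false, if_false]
    rfl
  | pair a b iha ihb =>
    rw [encOCode, toCode_four_mul_add _ 0 (by decide)]
    simp [Code.eval, evalo, iha, ihb]
    rfl
  | comp a b iha ihb =>
    rw [encOCode, toCode_four_mul_add _ 1 (by decide)]
    simp [Code.eval, evalo, iha, ihb]
    rfl
  | prec a b iha ihb =>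
    rw [encOCode, toCode_four_mul_add _ 2 (by decide)]
    simp [Code.eval, evalo, iha, ihb]
    rfl
  | rfind' a iha =>
    rw [encOCode, toCode_four_mul_add _ 3 (by decide)]
    simp [Code.eval, evalo, iha]
    rfl

theorem exists_encOCode_eq (n : ℕ) : ∃ c, encOCode c = n := by
  induction n using Nat.strong_induction_on with
  | _ n ih =>
    match n, ih with
    | 0, _ => exact ⟨.zero, rfl⟩
    | 1, _ => exact ⟨.succ, rfl⟩
    | 2, _ => exact ⟨.left, rfl⟩
    | 3, _ => exact ⟨.right, rfl⟩
    | 4, _ => exact ⟨.oracle, rfl⟩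
    | n + 5, ih =>
      obtain ⟨a, ha⟩ := ih (n / 4).unpair.1 ((Nat.unpair_left_le _).trans_lt (by omega))
      obtain ⟨b, hb⟩ := ih (n / 4).unpair.2 ((Nat.unpair_right_le _).trans_lt (by omega))
      obtain ⟨d, hd⟩ := ih (n / 4) (by omega)
      have hp : Nat.pair (encOCode a) (encOCode b) = n / 4 := by rw [ha, hb, Nat.pair_unpair]
      have : n % 4 = 0 ∨ n % 4 = 1 ∨ n % 4 = 2 ∨ n % 4 = 3 := by omega
      rcases this with h | h | h | h
      · exact ⟨.pair a b, by rw [encOCode, hp]; omega⟩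
      · exact ⟨.comp a b, by rw [encOCode, hp]; omega⟩
      · exact ⟨.prec a b, by rw [encOCode, hp]; omega⟩
      · exact ⟨.rfind' d, by rw [encOCode, hd]; omega⟩

theorem mem_jump_empty_iff (n : ℕ) : n ∈ jump ∅ ↔ ((toCode n).eval n).Dom := by
  constructor
  · rintro ⟨c, rfl, h⟩
    rwa [eval_toCode_encOCode]
  · obtain ⟨c, rfl⟩ := exists_encOCode_eq n
    exact fun h => ⟨c, rfl, by rwa [← eval_toCode_encOCode]⟩

theorem Nat.Partrec.Code.dom_eval_iff {c : Code} {n : ℕ} :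
    (c.eval n).Dom ↔ ∃ k, (Code.evaln k c n).isSome := by
  rw [Part.dom_iff_mem]
  simp_rw [Code.evaln_complete, Option.isSome_iff_exists]
  exact exists_comm

theorem exists_computable_mem_jump_empty_iff :
    ∃ e : ℕ → ℕ → Bool, Computable₂ e ∧ ∀ n, n ∈ jump ∅ ↔ ∃ k, e n k :=
  ⟨fun n k => (Code.evaln k (toCode n) n).isSome,
    (Primrec.option_isSome.comp <| Code.primrec_evaln.comp <|
      (Primrec.snd.pair (primrec_toCode.comp Primrec.fst)).pair Primrec.fst).to_comp.to₂,
    fun n => (mem_jump_empty_iff n).trans Code.dom_eval_iff⟩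

/-- A predicate of the form `∃ w, ∀ t, d a w t` with `d` decidable. -/
def IsSigmaTwo {α : Type*} [Primcodable α] (p : α → Prop) : Prop :=
  ∃ d : (α × ℕ) × ℕ → Bool, Computable d ∧ ∀ a, p a ↔ ∃ w, ∀ t, d ((a, w), t)

namespace IsSigmaTwo

variable {α β : Type*} [Primcodable α] [Primcodable β]

theorem of_iff {p q : α → Prop} (hp : IsSigmaTwo p) (h : ∀ a, q a ↔ p a) : IsSigmaTwo q := by
  obtain ⟨d, hd, hpd⟩ := hp
  exact ⟨d, hd, fun a => (h a).trans (hpd a)⟩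

theorem of_computable {f : α → Bool} (hf : Computable f) : IsSigmaTwo fun a => f a :=
  ⟨fun x => f x.1.1, hf.comp (Computable.fst.comp Computable.fst), by simp⟩

theorem of_primrecPred {p : α → Prop} (hp : PrimrecPred p) : IsSigmaTwo p := by
  classical
  exact (of_computable hp.decide.to_comp).of_iff (by simp)

theorem comp {p : β → Prop} (hp : IsSigmaTwo p) {f : α → β} (hf : Computable f) :
    IsSigmaTwo fun a => p (f a) := by
  obtain ⟨d, hd, hpd⟩ := hp
  exact ⟨fun x => d ((f x.1.1, x.1.2), x.2),
    hd.comp (((hf.comp (Computable.fst.comp Computable.fst)).pair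
      (Computable.snd.comp Computable.fst)).pair Computable.snd), fun a => hpd (f a)⟩

theorem and {p q : α → Prop} (hp : IsSigmaTwo p) (hq : IsSigmaTwo q) :
    IsSigmaTwo fun a => p a ∧ q a := by
  obtain ⟨d, hd, hpd⟩ := hp
  obtain ⟨e, he, hqe⟩ := hq
  have ha : Computable fun x : (α × ℕ) × ℕ => x.1.1 := Computable.fst.comp Computable.fst
  have hw : Computable fun x : (α × ℕ) × ℕ => x.1.2.unpair :=
    Computable.unpair.comp (Computable.snd.comp Computable.fst)
  refine ⟨fun x => d ((x.1.1, x.1.2.unpair.1), x.2) && e ((x.1.1, x.1.2.unpair.2), x.2),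
    Primrec.and.to_comp.comp
      (hd.comp ((ha.pair (Computable.fst.comp hw)).pair Computable.snd))
      (he.comp ((ha.pair (Computable.snd.comp hw)).pair Computable.snd)), fun a => ?_⟩
  simp only [Bool.and_eq_true, forall_and]
  rw [hpd, hqe]
  constructor
  · rintro ⟨⟨v, hv⟩, w, hw⟩
    exact ⟨Nat.pair v w, by simpa using hv, by simpa using hw⟩
  · rintro ⟨w, h₁, h₂⟩
    exact ⟨⟨_, h₁⟩, _, h₂⟩

theorem exists_mem {p : α → β → Prop} (hp : IsSigmaTwo fun x : α × β => p x.1 x.2) :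
    IsSigmaTwo fun a => ∃ b, p a b := by
  obtain ⟨d, hd, hpd⟩ := hp
  have hw : Computable fun x : (α × ℕ) × ℕ => x.1.2.unpair :=
    Computable.unpair.comp (Computable.snd.comp Computable.fst)
  refine ⟨fun x => Option.casesOn (motive := fun _ => Bool)
      (Encodable.decode (α := β) x.1.2.unpair.1) false
      fun b => d (((x.1.1, b), x.1.2.unpair.2), x.2),
    Computable.option_casesOn (Computable.decode.comp (Computable.fst.comp hw))
      (Computable.const false) (hd.comp ((((Computable.fst.comp
        (Computable.fst.comp Computable.fst)).pair Computable.snd).pair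
          (Computable.snd.comp (hw.comp Computable.fst))).pair
            (Computable.snd.comp Computable.fst))).to₂, fun a => ?_⟩
  constructor
  · rintro ⟨b, hb⟩
    obtain ⟨w, hw⟩ := (hpd (a, b)).1 hb
    exact ⟨Nat.pair (Encodable.encode b) w, by simpa using hw⟩
  · rintro ⟨w, hw⟩
    rcases h : Encodable.decode (α := β) w.unpair.1 with - | b
    · simp [h] at hw
    · simp only [h] at hw
      exact ⟨b, (hpd (a, b)).2 ⟨_, hw⟩⟩

theorem forall_lt {p : α → ℕ → Prop} (hp : IsSigmaTwo fun x : α × ℕ => p x.1 x.2)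
    {f : α → ℕ} (hf : Computable f) : IsSigmaTwo fun a => ∀ i < f a, p a i := by
  obtain ⟨d, hd, hpd⟩ := hp
  have ha : Computable fun x : (α × List ℕ) × ℕ => x.1.1 := Computable.fst.comp Computable.fst
  have ht : Computable fun x : (α × List ℕ) × ℕ => x.2.unpair :=
    Computable.unpair.comp Computable.snd
  have hi := Computable.fst.comp ht
  let e : (α × List ℕ) × ℕ → Bool := fun x =>
    bif decide (x.2.unpair.1 < f x.1.1) then
      d (((x.1.1, x.2.unpair.1), x.1.2.getD x.2.unpair.1 0), x.2.unpair.2)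
    else true
  have he : Computable e :=
    Computable.cond (Primrec.nat_lt.decide.to_comp.comp hi (hf.comp ha))
      (hd.comp (((ha.pair hi).pair ((Primrec.list_getD 0).to_comp.comp
        (Computable.snd.comp Computable.fst) hi)).pair (Computable.snd.comp ht)))
      (Computable.const true)
  have key (a : α) : (∀ i < f a, p a i) ↔ ∃ l : List ℕ, ∀ t, e ((a, l), t) := by
    constructor
    · intro h
      choose! w hw using fun i hi => (hpd (a, i)).1 (h i hi)
      refine ⟨(List.range (f a)).map w, fun t => ?_⟩
      by_cases hlt : t.unpair.1 < f a
      · simp [e, hlt, hw]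
      · simp [e, hlt]
    · rintro ⟨l, hl⟩ i hi
      refine (hpd (a, i)).2 ⟨l.getD i 0, fun t => ?_⟩
      simpa [e, hi] using hl (Nat.pair i t)
  refine ⟨fun x => e ((x.1.1, (Encodable.decode (α := List ℕ) x.1.2).getD []), x.2),
    he.comp (((Computable.fst.comp Computable.fst).pair (Computable.option_getD
      (Computable.decode.comp (Computable.snd.comp Computable.fst))
      (Computable.const []))).pair Computable.snd), fun a => (key a).trans ?_⟩
  constructor
  · rintro ⟨l, hl⟩
    exact ⟨Encodable.encode l, by simpa using hl⟩
  · rintro ⟨w, hw⟩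
    exact ⟨(Encodable.decode (α := List ℕ) w).getD [], hw⟩

end IsSigmaTwo

theorem isSigmaTwo_mem_chi_jump :
    IsSigmaTwo fun x : ℕ × ℕ => x.2 ∈ chi (jump ∅) x.1 := by
  obtain ⟨e, he, hje⟩ := exists_computable_mem_jump_empty_iff
  have hx : Computable fun x : ((ℕ × ℕ) × ℕ) × ℕ => x.1.1 :=
    Computable.fst.comp Computable.fst
  have heq (n : ℕ) : Computable fun x : ((ℕ × ℕ) × ℕ) × ℕ => decide (x.1.1.2 = n) :=
    Primrec.eq.decide.to_comp.comp (Computable.snd.comp hx) (Computable.const n)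
  refine ⟨fun x => bif decide (x.1.1.2 = 1) then e x.1.1.1 x.1.2
      else bif decide (x.1.1.2 = 0) then !e x.1.1.1 x.2 else false,
    Computable.cond (heq 1)
      (he.comp (Computable.fst.comp hx) (Computable.snd.comp Computable.fst))
      (Computable.cond (heq 0)
        (Primrec.not.to_comp.comp (he.comp (Computable.fst.comp hx) Computable.snd))
        (Computable.const false)), fun ⟨n, y⟩ => ?_⟩
  by_cases hn : n ∈ jump ∅
  · have := (hje n).1 hn
    rcases y with - | - | y <;> simp [chi, hn, this]
  · have := (hje n).not.1 hn
    rcases y with - | - | y <;> simp_all [chi]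

theorem List.exists_getD_eq (f : ℕ → ℕ) (n : ℕ) : ∃ l : List ℕ, ∀ i < n, l.getD i 0 = f i :=
  ⟨(List.range n).map f, fun i hi => by simp [hi]⟩

theorem mem_evalo_prec {O : ℕ →. ℕ} {a b : OCode} {n y : ℕ} :
    y ∈ evalo O (.prec a b) n ↔ ∃ l : List ℕ, l.getD 0 0 ∈ evalo O a n.unpair.1 ∧
      (∀ i < n.unpair.2,
        l.getD (i + 1) 0 ∈ evalo O b (Nat.pair n.unpair.1 (Nat.pair i (l.getD i 0)))) ∧
      y = l.getD n.unpair.2 0 := by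
  simp only [evalo, Nat.unpaired]
  generalize n.unpair.1 = x
  generalize n.unpair.2 = k
  induction k generalizing y with
  | zero =>
    constructor
    · exact fun h => ⟨[y], by simpa using h⟩
    · rintro ⟨l, h, -, rfl⟩
      exact h
  | succ k ih =>
    refine (Part.mem_bind_iff.trans (exists_congr fun z => and_congr_left' ih)).trans ?_
    constructor
    · rintro ⟨z, ⟨l, h₀, hs, rfl⟩, hy⟩
      obtain ⟨m, hm⟩ := List.exists_getD_eq
        (fun i => if i = k + 1 then y else l.getD i 0) (k + 2)
      refine ⟨m, ?_, fun i hi => ?_, ?_⟩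
      · rw [hm 0 (by omega)]
        simpa using h₀
      · rw [hm i (by omega), hm (i + 1) (by omega), if_neg (by omega : i ≠ k + 1)]
        rcases Nat.lt_succ_iff_lt_or_eq.1 hi with h | rfl
        · simpa [h.ne] using hs i h
        · simpa using hy
      · rw [hm (k + 1) (by omega), if_pos rfl]
    · rintro ⟨l, h₀, hs, rfl⟩
      exact ⟨_, ⟨l, h₀, fun i hi => hs i (hi.trans k.lt_succ_self), rfl⟩, hs k k.lt_succ_self⟩

theorem mem_evalo_rfind' {O : ℕ →. ℕ} {a : OCode} {n y : ℕ} :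
    y ∈ evalo O (.rfind' a) n ↔ n.unpair.2 ≤ y ∧ 0 ∈ evalo O a (Nat.pair n.unpair.1 y) ∧
      ∀ i < y - n.unpair.2, ∃ z, z ≠ 0 ∧ z ∈ evalo O a (Nat.pair n.unpair.1 (i + n.unpair.2)) := by
  have htrue (p : Part ℕ) : true ∈ (fun x => decide (x = 0)) <$> p ↔ 0 ∈ p := by simp
  have hfalse (p : Part ℕ) :
      false ∈ (fun x => decide (x = 0)) <$> p ↔ ∃ z, z ≠ 0 ∧ z ∈ p := by
    simp [and_comm]
  refine (Part.mem_map_iff _).trans ?_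
  constructor
  · rintro ⟨k, hk, rfl⟩
    obtain ⟨h₀, hlt⟩ := Nat.mem_rfind.1 hk
    refine ⟨Nat.le_add_left _ _, (htrue _).1 h₀, fun i hi => (hfalse _).1 (hlt ?_)⟩
    omega
  · rintro ⟨hle, h₀, hlt⟩
    refine ⟨y - n.unpair.2, Nat.mem_rfind.2 ⟨(htrue _).2 ?_, fun hi => (hfalse _).2 (hlt _ hi)⟩,
      Nat.sub_add_cancel hle⟩
    rwa [Nat.sub_add_cancel hle]

theorem isSigmaTwo_mem_evalo {O : ℕ →. ℕ} (hO : IsSigmaTwo fun x : ℕ × ℕ => x.2 ∈ O x.1)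
    (c : OCode) : IsSigmaTwo fun x : ℕ × ℕ => x.2 ∈ evalo O c x.1 := by
  induction c with
  | zero =>
    exact (IsSigmaTwo.of_primrecPred (Primrec.eq.comp Primrec.snd (.const 0))).of_iff
      fun x => Part.mem_some_iff
  | succ =>
    exact (IsSigmaTwo.of_primrecPred
      (Primrec.eq.comp Primrec.snd (Primrec.succ.comp Primrec.fst))).of_iff
      fun x => Part.mem_some_iff
  | left =>
    exact (IsSigmaTwo.of_primrecPred (Primrec.eq.comp Primrec.snd
      (Primrec.fst.comp (Primrec.unpair.comp Primrec.fst)))).of_iff fun x => Part.mem_some_iff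
  | right =>
    exact (IsSigmaTwo.of_primrecPred (Primrec.eq.comp Primrec.snd
      (Primrec.snd.comp (Primrec.unpair.comp Primrec.fst)))).of_iff fun x => Part.mem_some_iff
  | oracle => exact hO
  | pair a b iha ihb =>
    have hy : Computable fun x : ℕ × ℕ => x.2.unpair := Computable.unpair.comp Computable.snd
    refine ((iha.comp (Computable.fst.pair (Computable.fst.comp hy))).and
      (ihb.comp (Computable.fst.pair (Computable.snd.comp hy)))).of_iff fun ⟨n, y⟩ => ?_
    simp only [evalo, Seq.seq, Part.map_eq_map, Part.mem_bind_iff, Part.mem_map_iff]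
    constructor
    · rintro ⟨_, ⟨u, hu, rfl⟩, v, hv, rfl⟩
      simpa using ⟨hu, hv⟩
    · rintro ⟨hu, hv⟩
      exact ⟨_, ⟨_, hu, rfl⟩, _, hv, Nat.pair_unpair y⟩
  | comp a b iha ihb =>
    exact (IsSigmaTwo.exists_mem (p := fun (x : ℕ × ℕ) z => z ∈ evalo O b x.1 ∧ x.2 ∈ evalo O a z)
      ((ihb.comp ((Computable.fst.comp Computable.fst).pair Computable.snd)).and
        (iha.comp (Computable.snd.pair (Computable.snd.comp Computable.fst))))).of_iff
      fun x => Part.mem_bind_iff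
  | prec a b iha ihb =>
    have hn : Primrec fun x : (ℕ × ℕ) × List ℕ => x.1.1.unpair :=
      Primrec.unpair.comp (Primrec.fst.comp Primrec.fst)
    have hn₁ := Primrec.fst.comp hn
    have hn₂ := Primrec.snd.comp hn
    have hget {γ : Type} [Primcodable γ] {l : γ → List ℕ} (hl : Primrec l) {f : γ → ℕ}
        (hf : Primrec f) : Primrec fun x => (l x).getD (f x) 0 := (Primrec.list_getD 0).comp hl hf
    have hl : Primrec fun x : ((ℕ × ℕ) × List ℕ) × ℕ => x.1.2 := Primrec.snd.comp Primrec.fst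
    exact (IsSigmaTwo.exists_mem (p := fun (x : ℕ × ℕ) (l : List ℕ) => _)
      ((iha.comp (hn₁.pair (hget Primrec.snd (.const 0))).to_comp).and <|
        (IsSigmaTwo.forall_lt
          (p := fun (x : (ℕ × ℕ) × List ℕ) i => x.2.getD (i + 1) 0 ∈ evalo O b
            (Nat.pair x.1.1.unpair.1 (Nat.pair i (x.2.getD i 0))))
          (ihb.comp ((Primrec₂.natPair.comp (hn₁.comp Primrec.fst)
            (Primrec₂.natPair.comp Primrec.snd (hget hl Primrec.snd))).pair
              (hget hl (Primrec.succ.comp Primrec.snd))).to_comp) hn₂.to_comp).and <|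
        IsSigmaTwo.of_primrecPred (Primrec.eq.comp (Primrec.snd.comp Primrec.fst)
          (hget Primrec.snd hn₂)))).of_iff fun x => mem_evalo_prec
  | rfind' a iha =>
    have hn : Primrec fun x : ℕ × ℕ => x.1.unpair := Primrec.unpair.comp Primrec.fst
    have hn₁ := Primrec.fst.comp hn
    have hn₂ := Primrec.snd.comp hn
    exact ((IsSigmaTwo.of_primrecPred (Primrec.nat_le.comp hn₂ Primrec.snd)).and <|
      (iha.comp ((Primrec₂.natPair.comp hn₁ Primrec.snd).pair (.const 0)).to_comp).and <|
      IsSigmaTwo.forall_lt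
        (p := fun (x : ℕ × ℕ) i =>
          ∃ z, z ≠ 0 ∧ z ∈ evalo O a (Nat.pair x.1.unpair.1 (i + x.1.unpair.2)))
        (IsSigmaTwo.exists_mem
          (p := fun (x : (ℕ × ℕ) × ℕ) z =>
            z ≠ 0 ∧ z ∈ evalo O a (Nat.pair x.1.1.unpair.1 (x.2 + x.1.1.unpair.2)))
          ((IsSigmaTwo.of_primrecPred (Primrec.eq.comp Primrec.snd (.const 0)).not).and
            (iha.comp ((Primrec₂.natPair.comp (hn₁.comp (Primrec.fst.comp Primrec.fst))
              (Primrec.nat_add.comp (Primrec.snd.comp Primrec.fst)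
                (hn₂.comp (Primrec.fst.comp Primrec.fst)))).pair Primrec.snd).to_comp)))
        (Primrec.nat_sub.comp Primrec.snd hn₂).to_comp).of_iff fun x => mem_evalo_rfind'

theorem exists_computable_eval_eq {α : Type*} [Primcodable α] {f : α → ℕ →. ℕ} (hf : Partrec₂ f) :
    ∃ g : α → Code, Computable g ∧ ∀ a, (g a).eval = f a := by
  obtain ⟨c, hc⟩ := Code.exists_code.1 hf
  refine ⟨fun a => c.curry (Encodable.encode a),
    Code.primrec₂_curry.to_comp.comp (Computable.const c) Computable.encode, fun a => ?_⟩
  funext x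
  rw [Code.eval_curry, hc]
  simp only [Nat.unpair_pair, Encodable.decode_prod_val, Encodable.encodek, Option.map_some,
    Option.bind_some, Part.coe_some, Part.bind_some, Encodable.decode_nat]
  exact Part.map_id' (fun _ => rfl) _

theorem rfind_some_dom (f : ℕ → Bool) :
    (Nat.rfind fun t => Part.some (f t)).Dom ↔ ∃ t, f t :=
  Nat.rfind_dom.trans ⟨fun ⟨t, ht, _⟩ => ⟨t, (Part.mem_some_iff.1 ht).symm⟩,
    fun ⟨t, ht⟩ => ⟨t, Part.mem_some_iff.2 ht.symm, fun _ => trivial⟩⟩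

theorem exists_computable_dom_iff {α : Type*} [Primcodable α] {d : (α × ℕ) × ℕ → Bool}
    (hd : Computable d) {F : ℕ → ℕ} (hF : Computable F) :
    ∃ g : α → Code, Computable g ∧
      ∀ a x, x ∈ (g a).eval.Dom ↔ ∀ u ≤ x, F u ≤ x → ∃ t, d ((a, u), t) = false := by
  let b : ((α × ℕ) × (ℕ × ℕ)) → ℕ → Bool := fun y t =>
    !decide (F y.2.1 ≤ y.1.2) || !d ((y.1.1, y.2.1), t)
  have hb : Computable₂ b := by
    have hy : Computable fun y : ((α × ℕ) × (ℕ × ℕ)) × ℕ => y.1 := Computable.fst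
    have hu := Computable.fst.comp (Computable.snd.comp hy)
    have hax := Computable.fst.comp hy
    exact Primrec.or.to_comp.comp
      (Primrec.not.to_comp.comp (Primrec.nat_le.decide.to_comp.comp (hF.comp hu)
        (Computable.snd.comp hax)))
      (Primrec.not.to_comp.comp
        (hd.comp (((Computable.fst.comp hax).pair hu).pair Computable.snd)))
  let h : α × ℕ → ℕ × ℕ →. ℕ := fun y z => Nat.rfind fun t => Part.some (b (y, z) t)
  have hh : Partrec₂ h := Partrec.rfind (p := fun y t => Part.some (b y t)) hb.partrec₂
  let r : α × ℕ → ℕ → Part ℕ := fun y n =>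
    n.rec (Part.some 0) fun u IH => IH.bind fun i => h y (u, i)
  have hr : Partrec₂ fun (a : α) (x : ℕ) => r (a, x) (x + 1) :=
    Partrec.nat_rec (Computable.succ.comp Computable.snd) (Computable.const 0).partrec hh
  have hdom (a : α) (x n : ℕ) :
      (r (a, x) n).Dom ↔ ∀ u < n, F u ≤ x → ∃ t, d ((a, u), t) = false := by
    induction n with
    | zero => simp [r]
    | succ n ih =>
      have hs : (r (a, x) (n + 1)).Dom ↔
          (r (a, x) n).Dom ∧ (F n ≤ x → ∃ t, d ((a, n), t) = false) := by
        have hi (i : ℕ) : (h (a, x) (n, i)).Dom ↔ (F n ≤ x → ∃ t, d ((a, n), t) = false) :=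
          (rfind_some_dom _).trans (by by_cases hle : F n ≤ x <;> simp [b, hle])
        exact Part.bind_dom.trans ⟨fun ⟨hd, h'⟩ => ⟨hd, (hi _).1 h'⟩,
          fun ⟨hd, h'⟩ => ⟨hd, (hi _).2 h'⟩⟩
      rw [hs, ih]
      simp only [Nat.lt_succ_iff_lt_or_eq, or_imp, forall_and, forall_eq]
  obtain ⟨g, hg, hgr⟩ := exists_computable_eval_eq hr
  refine ⟨g, hg, fun a x => ?_⟩
  rw [hgr]
  have h := hdom a x (x + 1)
  simp only [Nat.lt_succ_iff] at h
  exact h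

theorem pcard_Iio (n : ℕ) : pcard (Set.Iio n) = Part.some n := by
  refine Part.ext' (by simp [pcard, Set.finite_Iio]) fun _ _ => ?_
  simp [pcard, Set.ncard_eq_toFinset_card']

theorem pcard_univ : pcard Set.univ = Part.none :=
  Part.ext' (by simp [pcard, Set.infinite_univ]) fun _ h => h.elim

theorem exists_computable_pcard {α : Type*} [Primcodable α] {d : (α × ℕ) × ℕ → Bool}
    (hd : Computable d) {F : ℕ → ℕ} (hF : Computable F) (hmono : Monotone F)
    (hle : ∀ u, u ≤ F u) :
    ∃ g : α → Code, Computable g ∧ ∀ a,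
      (∀ u, (∀ t, d ((a, u), t)) → (∀ v < u, ¬ ∀ t, d ((a, v), t)) →
        pcard (g a).eval.Dom = Part.some (F u)) ∧
      ((∀ u, ¬ ∀ t, d ((a, u), t)) → pcard (g a).eval.Dom = Part.none) := by
  obtain ⟨g, hg, hdom⟩ := exists_computable_dom_iff hd hF
  refine ⟨g, hg, fun a => ⟨fun u hu hlt => ?_, fun hall => ?_⟩⟩
  · rw [← pcard_Iio]
    congr 1
    ext x
    rw [hdom, Set.mem_Iio]
    constructor
    · intro h
      by_contra! hx
      obtain ⟨t, ht⟩ := h u ((hle u).trans hx) hx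
      simp [hu] at ht
    · intro hx v _ hv
      have hvu : v < u := by
        by_contra! h
        exact (hmono h).not_gt (hv.trans_lt hx)
      simpa using hlt v hvu
  · rw [← pcard_univ]
    congr 1
    ext x
    rw [hdom]
    simpa using fun u _ _ => by simpa using hall u

theorem encode_natCast_sub (a b : ℕ) :
    Encodable.encode ((a : ℤ) - b) = if b ≤ a then 2 * (a - b) else 2 * (b - a) - 1 := by
  have hnat (n : ℕ) : Encodable.encode (n : ℤ) = 2 * n := rfl
  have hneg (n : ℕ) : Encodable.encode (Int.negSucc n) = 2 * n + 1 := rfl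
  split_ifs with h
  · rw [← Nat.cast_sub h, hnat]
  · rw [show (a : ℤ) - b = Int.negSucc (b - a - 1) by omega, hneg]
    omega

theorem primrec_encode_natCast_sub :
    Primrec fun x : ℕ × ℕ => Encodable.encode ((x.1 : ℤ) - x.2) :=
  (Primrec.ite (Primrec.nat_le.comp Primrec.snd Primrec.fst)
    (Primrec.nat_mul.comp (.const 2) (Primrec.nat_sub.comp Primrec.fst Primrec.snd))
    (Primrec.nat_sub.comp
      (Primrec.nat_mul.comp (.const 2) (Primrec.nat_sub.comp Primrec.snd Primrec.fst))
      (.const 1))).of_eq fun x => (encode_natCast_sub x.1 x.2).symm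

theorem monotone_mul_self_add {f : ℕ → ℕ} (hf : ∀ n, f n ≤ n) :
    Monotone fun n => n * n + f n :=
  monotone_nat_of_le_succ fun n => by
    have := hf n
    nlinarith

theorem exists_computable_psub_of_isSigmaTwo {α : Type*} [Primcodable α] {G : α →. ℤ}
    (hG : IsSigmaTwo fun x : α × ℕ × ℕ => (x.2.1 : ℤ) - x.2.2 ∈ G x.1) :
    ∃ g₁ g₂ : α → Code, Computable g₁ ∧ Computable g₂ ∧
      ∀ a, G a = psub (pcard (g₁ a).eval.Dom) (pcard (g₂ a).eval.Dom) := by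
  obtain ⟨d, hd, hGd⟩ := hG
  have h₁ : Primrec fun u : ℕ => u.unpair.1 := Primrec.fst.comp Primrec.unpair
  have h₂ : Primrec fun u : ℕ => u.unpair.2 := Primrec.snd.comp Primrec.unpair
  have hu : Primrec fun x : (α × ℕ) × ℕ => x.1.2 := Primrec.snd.comp Primrec.fst
  let e : (α × ℕ) × ℕ → Bool := fun x =>
    d (((x.1.1, x.1.2.unpair.1, x.1.2.unpair.2.unpair.1), x.1.2.unpair.2.unpair.2), x.2)
  have he : Computable e :=
    hd.comp ((((Primrec.fst.comp Primrec.fst).pair ((h₁.comp hu).pair (h₁.comp (h₂.comp hu)))).pair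
      (h₂.comp (h₂.comp hu))).pair Primrec.snd).to_comp
  have hF {f : ℕ → ℕ} (hf : Primrec f) : Computable fun u => u * u + f u :=
    (Primrec.nat_add.comp (Primrec.nat_mul.comp .id .id) hf).to_comp
  have hle (f : ℕ → ℕ) (u : ℕ) : u ≤ u * u + f u := (Nat.le_mul_self u).trans (Nat.le_add_right _ _)
  obtain ⟨g₁, hg₁, H₁⟩ := exists_computable_pcard he (hF h₁)
    (monotone_mul_self_add fun u => u.unpair_left_le) (hle _)
  obtain ⟨g₂, hg₂, H₂⟩ := exists_computable_pcard he (hF (h₁.comp h₂))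
    (monotone_mul_self_add fun u => (Nat.unpair_left_le _).trans u.unpair_right_le) (hle _)
  refine ⟨g₁, g₂, hg₁, hg₂, fun a => ?_⟩
  by_cases hex : ∃ u, ∀ t, e ((a, u), t)
  · classical
    have hu := Nat.find_spec hex
    have hlt : ∀ v < Nat.find hex, ¬ ∀ t, e ((a, v), t) := fun v hv => Nat.find_min hex hv
    rw [(H₁ a).1 _ hu hlt, (H₂ a).1 _ hu hlt,
      Part.eq_some_iff.2 ((hGd (a, (Nat.find hex).unpair.1, (Nat.find hex).unpair.2.unpair.1)).2
        ⟨(Nat.find hex).unpair.2.unpair.2, hu⟩)]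
    simp [psub]
  · push Not at hex
    have hnone : G a = Part.none := Part.eq_none_iff.2 fun z hz => by
      obtain ⟨w, hw⟩ := (hGd (a, z.toNat, (-z).toNat)).1
        (by convert hz; simp only; omega)
      obtain ⟨t, ht⟩ := hex (Nat.pair z.toNat (Nat.pair (-z).toNat w))
      simp [e, hw t] at ht
    rw [(H₁ a).2 (by simpa using hex), hnone]
    simp [psub]

theorem Part.encode_mem_map_encode {α : Type*} [Encodable α] {o : Part α} {a : α} :
    Encodable.encode a ∈ o.map Encodable.encode ↔ a ∈ o := by
  simp [Part.mem_map_iff]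

/-- The oracle code that never calls the oracle and computes the same function as a `Code`. -/
def ofCode : Code → OCode
  | .zero => .zero
  | .succ => .succ
  | .left => .left
  | .right => .right
  | .pair a b => .pair (ofCode a) (ofCode b)
  | .comp a b => .comp (ofCode a) (ofCode b)
  | .prec a b => .prec (ofCode a) (ofCode b)
  | .rfind' a => .rfind' (ofCode a)

theorem evalo_ofCode (O : ℕ →. ℕ) (c : Code) : evalo O (ofCode c) = c.eval := by
  induction c with
  | zero => rfl
  | succ => rfl
  | left => rfl
  | right => rfl
  | pair a b iha ihb => simp only [ofCode, evalo, Code.eval, iha, ihb]; rfl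
  | comp a b iha ihb => simp only [ofCode, evalo, Code.eval, iha, ihb]; rfl
  | prec a b iha ihb => simp only [ofCode, evalo, Code.eval, iha, ihb]; rfl
  | rfind' a iha => simp only [ofCode, evalo, Code.eval, iha]; rfl

theorem evalo_comp (O : ℕ →. ℕ) (a b : OCode) (n : ℕ) :
    evalo O (.comp a b) n = (evalo O b n).bind fun m => evalo O a m := rfl

theorem evalo_pair (O : ℕ →. ℕ) (a b : OCode) (n : ℕ) :
    evalo O (.pair a b) n = ((evalo O a n).map Nat.pair).bind fun f => (evalo O b n).map f := rfl

theorem exists_evalo_eq (O : ℕ →. ℕ) {f : ℕ → ℕ} (hf : Computable f) :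
    ∃ c : OCode, ∀ n, evalo O c n = Part.some (f n) := by
  obtain ⟨c, hc⟩ := Code.exists_code.1 (Partrec.nat_iff.1 hf)
  exact ⟨ofCode c, fun n => by rw [evalo_ofCode, hc]; rfl⟩

theorem evalo_ofCode_const (O : ℕ →. ℕ) (n m : ℕ) :
    evalo O (ofCode (Code.const n)) m = Part.some n := by
  rw [evalo_ofCode, Code.eval_const]

theorem primrec_encOCode_const : Primrec fun n => encOCode (ofCode (Code.const n)) := by
  have h : Primrec (Nat.rec 0 fun _ e => 4 * Nat.pair 1 e + 6 : ℕ → ℕ) :=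
    Primrec.nat_rec₁ 0 <| Primrec.nat_add.comp (Primrec.nat_mul.comp (.const 4)
      (Primrec₂.natPair.comp (.const 1) Primrec.snd)) (.const 6)
  refine h.of_eq fun n => ?_
  induction n with
  | zero => rfl
  | succ n ih => simp only [Code.const, ofCode, encOCode, ← ih]

open Classical in
/-- The halting problem decides every existential statement with a decidable matrix. -/
theorem exists_evalo_eq_ite {f : ℕ → ℕ → Bool} (hf : Computable₂ f) :
    ∃ c : OCode, ∀ n, evalo (chi (jump ∅)) c n = Part.some (if ∃ s, f n s then 1 else 0) := by
  obtain ⟨c, hc⟩ := Code.exists_code.1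
    (Partrec.nat_iff.1 (Partrec.rfind (p := fun n s => Part.some (f n s)) hf.partrec₂))
  let h : ℕ → ℕ := fun n => encOCode (.comp (ofCode c) (ofCode (Code.const n)))
  have hh : Computable h :=
    (Primrec.nat_add.comp (Primrec.nat_mul.comp (.const 4)
      (Primrec₂.natPair.comp (.const _) primrec_encOCode_const)) (.const 6)).to_comp
  have hmem (n : ℕ) : h n ∈ jump ∅ ↔ ∃ s, f n s := by
    rw [mem_jump_empty_iff, eval_toCode_encOCode, evalo_comp, evalo_ofCode_const, Part.bind_some,
      evalo_ofCode, hc]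
    exact rfind_some_dom _
  obtain ⟨e, he⟩ := exists_evalo_eq (chi (jump ∅)) hh
  refine ⟨.comp .oracle e, fun n => ?_⟩
  rw [evalo_comp, he, Part.bind_some]
  simp only [evalo, chi, hmem]

/-- The number of elements of `W_c` found within `s` steps. -/
def stageCount (c : Code) (s : ℕ) : ℕ := Nat.count (fun x => (Code.evaln s c x).isSome) s

theorem primrec_stageCount : Primrec₂ stageCount := by
  let h : Code × ℕ → ℕ × ℕ → ℕ := fun y z =>
    z.2 + bif (Code.evaln y.2 y.1 z.1).isSome then 1 else 0
  have hh : Primrec₂ h := Primrec.nat_add.comp (Primrec.snd.comp Primrec.snd)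
    (Primrec.cond (Primrec.option_isSome.comp (Code.primrec_evaln.comp
      (((Primrec.snd.comp Primrec.fst).pair (Primrec.fst.comp Primrec.fst)).pair
        (Primrec.fst.comp Primrec.snd)))) (.const 1) (.const 0))
  refine (Primrec.nat_rec' Primrec.snd (.const 0) hh).of_eq fun ⟨c, s⟩ => ?_
  suffices ∀ n, (n.rec 0 fun x i => h (c, s) (x, i) : ℕ) =
      Nat.count (fun x => (Code.evaln s c x).isSome) n from this s
  intro n
  induction n with
  | zero => rfl
  | succ n ih =>
    rw [Nat.count_succ, ← ih]
    simp only [h, Bool.cond_eq_ite]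

theorem exists_lt_stageCount_iff (c : Code) (n : ℕ) :
    (∃ s, n < stageCount c s) ↔ (n : ℕ∞) < c.eval.Dom.encard := by
  have hsub (s : ℕ) : (stageCount c s : ℕ∞) ≤ c.eval.Dom.encard := by
    rw [stageCount, Nat.count_eq_card_filter_range, ← Set.encard_coe_eq_coe_finsetCard]
    refine Set.encard_le_encard fun x hx => Code.dom_eval_iff.2 ⟨s, ?_⟩
    simp_all
  constructor
  · rintro ⟨s, hs⟩
    exact lt_of_lt_of_le (Nat.cast_lt.2 hs) (hsub s)
  · intro h
    obtain ⟨t, ht, hcard⟩ := Set.exists_subset_encard_eq (Order.add_one_le_of_lt h)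
    have hfin : t.Finite := Set.finite_of_encard_eq_coe (k := n + 1) (by exact_mod_cast hcard)
    lift t to Finset ℕ using hfin
    have hev (x : ℕ) (hx : x ∈ t) : ∃ k, (Code.evaln k c x).isSome :=
      Code.dom_eval_iff.1 (ht hx)
    choose! k hk using hev
    refine ⟨t.sup k, ?_⟩
    have hle : t.card ≤ stageCount c (t.sup k) := by
      rw [stageCount, Nat.count_eq_card_filter_range]
      refine Finset.card_le_card fun x hx => ?_
      obtain ⟨v, hv⟩ := Option.isSome_iff_exists.1 (hk x hx)
      have hv' := Code.evaln_mono (Finset.le_sup (f := k) hx) hv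
      exact Finset.mem_filter.2 ⟨Finset.mem_range.2 (Code.evaln_bound hv'),
        Option.isSome_iff_exists.2 ⟨v, hv'⟩⟩
    rw [Set.encard_coe_eq_coe_finsetCard] at hcard
    have : t.card = n + 1 := by exact_mod_cast hcard
    omega

theorem mem_pcard_iff (S : Set ℕ) (n : ℕ) : n ∈ pcard S ↔ S.encard = n := by
  constructor
  · rintro ⟨hfin, rfl⟩
    exact (Set.Finite.cast_ncard_eq hfin).symm
  · intro h
    have hfin := Set.finite_of_encard_eq_coe h
    exact ⟨hfin, by exact_mod_cast hfin.cast_ncard_eq.trans h⟩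

theorem exists_evalo_eq_pcard {α : Type*} [Primcodable α] {g : α → Code} (hg : Computable g) :
    ∃ c : OCode, ∀ a, evalo (chi (jump ∅)) c (Encodable.encode a) = pcard (g a).eval.Dom := by
  classical
  let f : ℕ → ℕ → Bool := fun y s =>
    Option.casesOn (motive := fun _ => Bool) (Encodable.decode (α := α) y.unpair.1) false
      fun a => decide (y.unpair.2 < stageCount (g a) s)
  have hf : Computable₂ f := by
    have hy : Computable fun y : ℕ × ℕ => y.1.unpair := Computable.unpair.comp Computable.fst
    exact Computable.option_casesOn (Computable.decode.comp (Computable.fst.comp hy))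
      (Computable.const false) (Primrec.nat_lt.decide.to_comp.comp
        (Computable.snd.comp (hy.comp Computable.fst))
        (primrec_stageCount.to_comp.comp (hg.comp Computable.snd)
          (Computable.snd.comp Computable.fst)))
  obtain ⟨c, hc⟩ := exists_evalo_eq_ite hf
  obtain ⟨i, hi⟩ := exists_evalo_eq (chi (jump ∅)) (f := fun n => Nat.pair n 0)
    (Primrec₂.natPair.comp .id (.const 0)).to_comp
  refine ⟨.comp (.rfind' c) i, fun a => Part.ext fun n => ?_⟩
  have hiff (n : ℕ) : (∃ s, f (Nat.pair (Encodable.encode a) n) s) ↔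
      n < (g a).eval.Dom.encard := by
    simp [f, exists_lt_stageCount_iff]
  have h₀ (p : Prop) [Decidable p] : 0 ∈ Part.some (if p then 1 else 0) ↔ ¬ p := by
    by_cases hp : p <;> simp [hp]
  have h₁ (p : Prop) [Decidable p] : (∃ z, z ≠ 0 ∧ z ∈ Part.some (if p then 1 else 0)) ↔ p := by
    by_cases hp : p <;> simp [hp]
  have hcomp : evalo (chi (jump ∅)) (.comp (.rfind' c) i) (Encodable.encode a) =
      evalo (chi (jump ∅)) (.rfind' c) (Nat.pair (Encodable.encode a) 0) := by
    rw [evalo_comp, hi, Part.bind_some]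
  rw [hcomp, mem_evalo_rfind', mem_pcard_iff]
  simp only [hc, h₀, h₁, Nat.unpair_pair, hiff, Nat.add_zero, Nat.sub_zero, Nat.zero_le, true_and,
    not_lt]
  constructor
  · rintro ⟨hle, hlt⟩
    refine hle.antisymm ?_
    rcases n with - | n
    · simp
    · simpa using Order.add_one_le_of_lt (hlt n n.lt_succ_self)
  · intro h
    rw [h]
    exact ⟨le_rfl, fun i hi => Nat.cast_lt.2 hi⟩

theorem stmt12 (G : List Bool →. ℤ) :
    RecInP (jump (∅ : Set ℕ)) G ↔
    ∃ g₁ g₂ : List Bool → Nat.Partrec.Code, Computable g₁ ∧ Computable g₂ ∧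
      ∀ p : List Bool,
        G p = psub (pcard ((g₁ p).eval.Dom)) (pcard ((g₂ p).eval.Dom)) := by
  constructor
  · rintro ⟨c, hc⟩
    refine exists_computable_psub_of_isSigmaTwo (((isSigmaTwo_mem_evalo isSigmaTwo_mem_chi_jump
      c).comp ((Computable.encode.comp Computable.fst).pair
        (primrec_encode_natCast_sub.to_comp.comp Computable.snd))).of_iff fun x => ?_)
    simp only [hc]
    exact Part.encode_mem_map_encode.symm
  · rintro ⟨g₁, g₂, hg₁, hg₂, hG⟩
    obtain ⟨c₁, hc₁⟩ := exists_evalo_eq_pcard hg₁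
    obtain ⟨c₂, hc₂⟩ := exists_evalo_eq_pcard hg₂
    obtain ⟨e, he⟩ := exists_evalo_eq (chi (jump ∅))
      (primrec_encode_natCast_sub.comp Primrec.unpair).to_comp
    refine ⟨.comp e (.pair c₁ c₂), fun p => ?_⟩
    rw [hG]
    generalize ha : pcard (g₁ p).eval.Dom = a at *
    generalize hb : pcard (g₂ p).eval.Dom = b at *
    simp only [evalo_comp, evalo_pair, hc₁, hc₂, ha, hb]
    induction a using Part.induction_on <;> induction b using Part.induction_on <;>
      simp [psub, he]
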